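/- Let (R,Λ,S) be a generalised Renner–Coxeter system with length function ℓ, let r ∈ R with normal decomposition (w₁, e, w₂), and s ∈ S. Then ℓ(sr) = ℓ(r) if and only if sr = r, which happens if and only if s·w₁ = w₁·u for some u ∈ λ_⋆(e); in that case ℓ(sw₁) = ℓ(w₁)+1 in W. Otherwise ℓ(sr) = ℓ(r) ± 1 and the normal decomposition of sr is (sw₁, e, w₂) with ℓ(sr) − ℓ(r) = ℓ(sw₁) − ℓ(w₁). -/

import Mathlib

noncomputable section

/-- A generalised Renner–Coxeter system on a monoid `R`: a Coxeter system `(Rˣ, S)` on the unit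
group (indexed by `B`, with data `cm`, `cs`), a cross-section semilattice `Λ` of idempotents,
and type maps `lam = λ`, `lamStar = λ_⋆` satisfying axioms (ECS1)–(ECS6). -/
structure GRCSystem (B : Type*) (R : Type*) [Monoid R] where
  /-- The Coxeter matrix indexing the simple reflections `S`. -/
  cm : CoxeterMatrix B
  /-- (ECS3): the unit group of `R` is a Coxeter group. -/
  cs : CoxeterSystem cm Rˣ
  /-- The cross-section lattice `Λ`. -/
  Λ : Set R
  /-- The type map `λ`, with `W(e) = W_{λ(e)}`. -/
  lam : R → Set B
  /-- The map `λ_⋆`, with `W_⋆(e) = W_{λ_⋆(e)}`. -/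
  lamStar : R → Set B
  /-- (ECS1): idempotents commute, i.e. `E(R)` is a (lower) semilattice. -/
  idem_mul_comm : ∀ e f : R, IsIdempotentElem e → IsIdempotentElem f → e * f = f * e
  /-- (ECS1): `R` is unit regular (factorisable). -/
  factor : ∀ r : R, ∃ (e : R) (g : Rˣ), IsIdempotentElem e ∧ r = e * (g : R)
  /-- (ECS2): elements of `Λ` are idempotent. -/
  lam_idem : ∀ e ∈ Λ, IsIdempotentElem e
  /-- (ECS2): `Λ` is a sub-semilattice of `E(R)`. -/
  lam_mul_mem : ∀ e ∈ Λ, ∀ f ∈ Λ, e * f ∈ Λ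
  /-- (ECS2): `Λ` is a transversal of `E(R)` for the conjugation action of the unit group. -/
  transversal : ∀ e : R, IsIdempotentElem e →
    ∃! f : R, f ∈ Λ ∧ ∃ w : Rˣ, (w : R) * f * ((w⁻¹ : Rˣ) : R) = e
  /-- (ECS4): comparable idempotents are simultaneously conjugate to a comparable pair in `Λ`. -/
  ecs4 : ∀ e₁ e₂ : R, IsIdempotentElem e₁ → IsIdempotentElem e₂ →
    e₁ * e₂ = e₁ → e₂ * e₁ = e₁ →
    ∃ (w : Rˣ) (f₁ f₂ : R), f₁ ∈ Λ ∧ f₂ ∈ Λ ∧ f₁ * f₂ = f₁ ∧ f₂ * f₁ = f₁ ∧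
      (w : R) * f₁ * ((w⁻¹ : Rˣ) : R) = e₁ ∧ (w : R) * f₂ * ((w⁻¹ : Rˣ) : R) = e₂
  /-- (ECS5): `W(e)` is the standard parabolic subgroup on `λ(e)`. -/
  mem_lam_iff : ∀ e ∈ Λ, ∀ w : Rˣ,
    ((w : R) * e = e * (w : R)) ↔ w ∈ Subgroup.closure (cs.simple '' lam e)
  /-- (ECS5): `W_⋆(e)` is the standard parabolic subgroup on `λ_⋆(e)`. -/
  mem_lamStar_iff : ∀ e ∈ Λ, ∀ w : Rˣ,
    ((w : R) * e = e ∧ e * (w : R) = e) ↔ w ∈ Subgroup.closure (cs.simple '' lamStar e)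
  /-- (ECS6): the map `e ↦ λ^⋆(e)` is order preserving. -/
  ecs6 : ∀ e ∈ Λ, ∀ f ∈ Λ, e * f = e →
    ∀ s : B, ((cs.simple s : R) * e = e * (cs.simple s : R) ∧ (cs.simple s : R) * e ≠ e) →
      ((cs.simple s : R) * f = f * (cs.simple s : R) ∧ (cs.simple s : R) * f ≠ f)

namespace GRCSystem

variable {B R : Type*} [Monoid R] (G : GRCSystem B R)

/-- The standard parabolic subgroup `W_I` of the unit group of `R`. -/
def parab (I : Set B) : Subgroup Rˣ := Subgroup.closure (G.cs.simple '' I)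

/-- The set `λ^⋆(e) = {s ∈ S : s e = e s ≠ e}`. -/
def lamCostar (e : R) : Set B :=
  {s : B | (G.cs.simple s : R) * e = e * (G.cs.simple s : R) ∧ (G.cs.simple s : R) * e ≠ e}

/-- Value in `R` of a letter of the alphabet `S ⊔ R`. -/
def letterVal : B ⊕ R → R := Sum.elim (fun s => ((G.cs.simple s : Rˣ) : R)) id

/-- A word on the alphabet `S ∪ (Λ ∖ {1})`: every `inr` letter is a nonidentity element of `Λ`. -/
def IsWord (l : List (B ⊕ R)) : Prop := ∀ e : R, Sum.inr e ∈ l → e ∈ G.Λ ∧ e ≠ 1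

/-- The length of a word: letters from `S` count 1, letters from `Λ` count 0. -/
def wordLen (l : List (B ⊕ R)) : ℕ := (l.filter Sum.isLeft).length

/-- The length `ℓ(r)`: the minimal length of a word on `S ∪ (Λ ∖ {1})` representing `r`. -/
def len (r : R) : ℕ :=
  sInf {n : ℕ | ∃ l : List (B ⊕ R), G.IsWord l ∧ (l.map G.letterVal).prod = r ∧ n = wordLen l}

/-- `(w₁, e, w₂)` is the normal decomposition of `r`: `e ∈ Λ`, `w₁` is `(∅, λ_⋆(e))`-reduced
(minimal length in `w₁ W_{λ_⋆(e)}`), `w₂` is `(λ(e), ∅)`-reduced (minimal length in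
`W_{λ(e)} w₂`), and `r = w₁ e w₂`. -/
def IsNormalDecomp (r : R) (w₁ : Rˣ) (e : R) (w₂ : Rˣ) : Prop :=
  e ∈ G.Λ ∧
  (∀ u ∈ G.parab (G.lamStar e), G.cs.length w₁ ≤ G.cs.length (w₁ * u)) ∧
  (∀ u ∈ G.parab (G.lam e), G.cs.length w₂ ≤ G.cs.length (u * w₂)) ∧
  r = (w₁ : R) * e * (w₂ : R)

/-- `w` is `(I,J)`-reduced: `w` has minimal length in the double coset `W_I w W_J`. -/
def IsRed (I J : Set B) (w : Rˣ) : Prop :=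
  ∀ u ∈ G.parab I, ∀ v ∈ G.parab J, G.cs.length w ≤ G.cs.length (u * w * v)

end GRCSystem

namespace CoxeterSystem

variable {B W : Type*} [Group W] {M : CoxeterMatrix B} (cs : CoxeterSystem M W)

open scoped Classical in
/-- The action of a simple reflection `s` on pairs `(t, ε)`: conjugate `t` by `s`, and flip the
sign `ε` if `t = s`. -/
def signedConj (i : B) : Function.End (W × ZMod 2) := fun p =>
  (cs.simple i * p.1 * cs.simple i, p.2 + if p.1 = cs.simple i then 1 else 0)

open scoped Classical in
theorem signedConj_mul_pow (i j : B) (k : ℕ) (p : W × ZMod 2) :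
    ((cs.signedConj i * cs.signedConj j) ^ k) p =
      ((cs.simple i * cs.simple j) ^ k * p.1 * ((cs.simple i * cs.simple j) ^ k)⁻¹,
        p.2 + ∑ n ∈ Finset.range (2 * k),
          if p.1 = cs.simple j * (cs.simple i * cs.simple j) ^ n then 1 else 0) := by
  induction k with
  | zero => simp [show (1 : Function.End (W × ZMod 2)) p = p from rfl]
  | succ k ih =>
    rw [pow_succ']
    change cs.signedConj i (cs.signedConj j (((cs.signedConj i * cs.signedConj j) ^ k) p)) = _
    rw [ih]
    set c := cs.simple i * cs.simple j with hc
    have hj : cs.simple j * cs.simple j = 1 := cs.simple_mul_simple_self j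
    have hij : cs.simple i = c * cs.simple j := by rw [hc, mul_assoc, hj, mul_one]
    have hjc : ∀ n : ℕ, cs.simple j * c ^ n = (c ^ n)⁻¹ * cs.simple j := by
      intro n
      have h1 : cs.simple j * c * (cs.simple j)⁻¹ = c⁻¹ := by
        rw [hc, mul_inv_rev, cs.inv_simple, cs.inv_simple, mul_assoc, mul_assoc, hj, mul_one]
      rw [← mul_inv_eq_iff_eq_mul, ← conj_pow, h1, inv_pow]
    have e1 : c ^ k * p.1 * (c ^ k)⁻¹ = cs.simple j ↔ p.1 = cs.simple j * c ^ (2 * k) := by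
      rw [two_mul, pow_add, ← mul_assoc, hjc, mul_inv_eq_iff_eq_mul,
        ← eq_inv_mul_iff_mul_eq, mul_assoc]
    have e2 : cs.simple j * (c ^ k * p.1 * (c ^ k)⁻¹) * cs.simple j = cs.simple i ↔
        p.1 = cs.simple j * c ^ (2 * k + 1) := by
      have h2 : cs.simple j * c ^ (2 * k + 1) = (c ^ k)⁻¹ * (cs.simple j * c) * c ^ k := by
        rw [show 2 * k + 1 = k + (1 + k) by ring, pow_add, pow_add, pow_one, ← mul_assoc, hjc]
        simp only [mul_assoc]
      rw [h2, hij, mul_left_inj, ← eq_inv_mul_iff_mul_eq, cs.inv_simple,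
        mul_inv_eq_iff_eq_mul, ← eq_inv_mul_iff_mul_eq, ← mul_assoc]
    simp only [signedConj, Prod.mk.injEq]
    constructor
    · have : (c ^ (k + 1))⁻¹ = (c ^ k)⁻¹ * (cs.simple j * cs.simple i) := by
        rw [pow_succ', mul_inv_rev, hc, mul_inv_rev, cs.inv_simple, cs.inv_simple]
      rw [this, pow_succ']
      simp only [hc, mul_assoc]
    · rw [show 2 * (k + 1) = 2 * k + 1 + 1 by ring, Finset.sum_range_succ, Finset.sum_range_succ]
      simp only [e1, e2, add_assoc]

theorem isLiftable_signedConj : M.IsLiftable cs.signedConj := by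
  classical
  intro i j
  funext p
  rw [signedConj_mul_pow, cs.simple_mul_simple_pow, two_mul, Finset.sum_range_add]
  simp only [pow_add, cs.simple_mul_simple_pow, one_mul, CharTwo.add_self_eq_zero]
  simp [show (1 : Function.End (W × ZMod 2)) p = p from rfl]

/-- The action of `W` on pairs `(t, ε)` extending `signedConj`. -/
def signedConjHom : W →* Function.End (W × ZMod 2) :=
  cs.lift ⟨cs.signedConj, cs.isLiftable_signedConj⟩

theorem signedConjHom_simple (i : B) : cs.signedConjHom (cs.simple i) = cs.signedConj i :=
  cs.lift_apply_simple cs.isLiftable_signedConj i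

open scoped Classical in
theorem signedConjHom_wordProd (ω : List B) (p : W × ZMod 2) :
    cs.signedConjHom (cs.wordProd ω) p =
      (cs.wordProd ω * p.1 * (cs.wordProd ω)⁻¹, p.2 + ((cs.rightInvSeq ω).count p.1 : ℕ)) := by
  induction ω with
  | nil => simp [show (1 : Function.End (W × ZMod 2)) p = p from rfl]
  | cons i ω ih =>
    rw [wordProd_cons, map_mul]
    change cs.signedConjHom (cs.simple i) (cs.signedConjHom (cs.wordProd ω) p) = _
    rw [ih, signedConjHom_simple]
    have e : cs.wordProd ω * p.1 * (cs.wordProd ω)⁻¹ = cs.simple i ↔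
        (cs.wordProd ω)⁻¹ * cs.simple i * cs.wordProd ω = p.1 := by
      rw [mul_inv_eq_iff_eq_mul, ← eq_inv_mul_iff_mul_eq, ← mul_assoc, eq_comm]
    simp only [signedConj, rightInvSeq, List.count_cons, e, beq_iff_eq]
    ext
    · simp [mul_assoc]
    · push_cast
      ring

theorem simple_mem_rightInvSeq_of_isRightDescent {ω : List B} {i : B}
    (h : cs.IsRightDescent (cs.wordProd ω) i) : cs.simple i ∈ cs.rightInvSeq ω := by
  classical
  obtain ⟨ν, hν, hνω⟩ := cs.exists_isReduced (cs.wordProd ω * cs.simple i)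
  have hnot : cs.simple i ∉ cs.rightInvSeq ν := by
    intro hm
    have h1 := (cs.isRightInversion_of_mem_rightInvSeq hν hm).2
    rw [← hνω, mul_assoc, cs.simple_mul_simple_self, mul_one] at h1
    exact lt_asymm h h1
  have hω : cs.wordProd ω = cs.wordProd ν * cs.simple i := by
    rw [← hνω, mul_assoc, cs.simple_mul_simple_self, mul_one]
  have key : (cs.signedConjHom (cs.wordProd ω) (cs.simple i, 0)).2 = 1 := by
    rw [hω, map_mul]
    change (cs.signedConjHom (cs.wordProd ν)
      (cs.signedConjHom (cs.simple i) (cs.simple i, 0))).2 = 1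
    rw [signedConjHom_simple, signedConjHom_wordProd]
    simp [signedConj, List.count_eq_zero.mpr hnot]
  rw [signedConjHom_wordProd] at key
  by_contra hm
  simp [List.count_eq_zero.mpr hm] at key

/-- The exchange condition, on the right. -/
theorem exists_eraseIdx_of_isRightDescent {ω : List B} {i : B}
    (h : cs.IsRightDescent (cs.wordProd ω) i) :
    ∃ j < ω.length, cs.wordProd ω * cs.simple i = cs.wordProd (ω.eraseIdx j) := by
  obtain ⟨j, hj, hji⟩ := List.mem_iff_getElem.mp (cs.simple_mem_rightInvSeq_of_isRightDescent h)
  refine ⟨j, by simpa using hj, ?_⟩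
  rw [← wordProd_mul_getD_rightInvSeq, List.getD_eq_getElem _ 1 hj, hji]

/-- The exchange condition, on the left. -/
theorem exists_eraseIdx_of_isLeftDescent {ω : List B} {i : B}
    (h : cs.IsLeftDescent (cs.wordProd ω) i) :
    ∃ j < ω.length, cs.simple i * cs.wordProd ω = cs.wordProd (ω.eraseIdx j) := by
  have hmem : cs.simple i ∈ cs.leftInvSeq ω := by
    rw [← cs.isRightDescent_inv_iff, ← wordProd_reverse] at h
    simpa [rightInvSeq_reverse] using cs.simple_mem_rightInvSeq_of_isRightDescent h
  obtain ⟨j, hj, hji⟩ := List.mem_iff_getElem.mp hmem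
  refine ⟨j, by simpa using hj, ?_⟩
  rw [← getD_leftInvSeq_mul_wordProd, List.getD_eq_getElem _ 1 hj, hji]

/-- The deletion condition. -/
theorem exists_isReduced_sublist (ω : List B) :
    ∃ ν, List.Sublist ν ω ∧ cs.IsReduced ν ∧ cs.wordProd ν = cs.wordProd ω := by
  induction ω using List.reverseRecOn with
  | nil => exact ⟨[], List.Sublist.refl _, by simp [IsReduced], rfl⟩
  | append_singleton ω i ih =>
    obtain ⟨ν, hsub, hred, hprod⟩ := ih
    rcases cs.length_mul_simple (cs.wordProd ν) i with hl | hl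
    · refine ⟨ν ++ [i], hsub.append (List.Sublist.refl _), ?_, ?_⟩
      · simp [IsReduced, wordProd_append, hl, hred.eq]
      · simp [wordProd_append, hprod]
    · obtain ⟨j, hj, he⟩ := cs.exists_eraseIdx_of_isRightDescent
        (show cs.IsRightDescent (cs.wordProd ν) i by unfold IsRightDescent; omega)
      refine ⟨ν.eraseIdx j, ((List.eraseIdx_sublist ν j).trans hsub).trans
        (List.sublist_append_left _ _), ?_, ?_⟩
      · have := List.length_eraseIdx_add_one hj
        have := hred.eq
        rw [IsReduced, ← he]
        omega
      · rw [← he, hprod, wordProd_append, wordProd_singleton]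

theorem exists_word_of_mem_closure {I : Set B} {w : W}
    (hw : w ∈ Subgroup.closure (cs.simple '' I)) :
    ∃ ω : List B, (∀ i ∈ ω, i ∈ I) ∧ cs.wordProd ω = w := by
  induction hw using Subgroup.closure_induction with
  | mem x hx =>
    obtain ⟨i, hi, rfl⟩ := hx
    exact ⟨[i], by simpa using hi, by simp⟩
  | one => exact ⟨[], by simp, by simp⟩
  | mul x y _ _ hx hy =>
    obtain ⟨ω, hω, rfl⟩ := hx
    obtain ⟨ν, hν, rfl⟩ := hy
    exact ⟨ω ++ ν, by grind, by rw [wordProd_append]⟩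
  | inv x _ hx =>
    obtain ⟨ω, hω, rfl⟩ := hx
    exact ⟨ω.reverse, by simpa using hω, by rw [wordProd_reverse]⟩

theorem wordProd_mem {P : Subgroup W} {ω : List B} (hω : ∀ i ∈ ω, cs.simple i ∈ P) :
    cs.wordProd ω ∈ P :=
  Subgroup.list_prod_mem _ (by simpa using hω)

theorem wordProd_mem_closure {I : Set B} {ω : List B} (hω : ∀ i ∈ ω, i ∈ I) :
    cs.wordProd ω ∈ Subgroup.closure (cs.simple '' I) :=
  cs.wordProd_mem fun i hi => Subgroup.subset_closure ⟨i, hω i hi, rfl⟩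

theorem exists_isReduced_of_mem_closure {I : Set B} {w : W}
    (hw : w ∈ Subgroup.closure (cs.simple '' I)) :
    ∃ ω : List B, (∀ i ∈ ω, i ∈ I) ∧ cs.IsReduced ω ∧ cs.wordProd ω = w := by
  obtain ⟨ω, hω, rfl⟩ := cs.exists_word_of_mem_closure hw
  obtain ⟨ν, hsub, hred, hprod⟩ := cs.exists_isReduced_sublist ω
  exact ⟨ν, fun i hi => hω i (hsub.subset hi), hred, hprod⟩

/-- If `d` is minimal in `W_I d W_J`, every element of this double coset is a length-additive
product `x' d y'` with `x' ∈ W_I` and `y' ∈ W_J`. -/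
theorem exists_length_add_of_minimal {I J : Set B} {d : W}
    (hd : ∀ u ∈ Subgroup.closure (cs.simple '' I), ∀ v ∈ Subgroup.closure (cs.simple '' J),
      cs.length d ≤ cs.length (u * d * v))
    {x y : W} (hx : x ∈ Subgroup.closure (cs.simple '' I))
    (hy : y ∈ Subgroup.closure (cs.simple '' J)) :
    ∃ x' ∈ Subgroup.closure (cs.simple '' I), ∃ y' ∈ Subgroup.closure (cs.simple '' J),
      x * d * y = x' * d * y' ∧
      cs.length (x * d * y) = cs.length x' + cs.length d + cs.length y' := by
  obtain ⟨ωx, hωx, rfl⟩ := cs.exists_word_of_mem_closure hx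
  obtain ⟨ωy, hωy, rfl⟩ := cs.exists_word_of_mem_closure hy
  obtain ⟨ωd, hωd, rfl⟩ := cs.exists_isReduced d
  obtain ⟨ν, hsub, hred, hprod⟩ := cs.exists_isReduced_sublist (ωx ++ ωd ++ ωy)
  obtain ⟨ν', νy, rfl, hν', hνy⟩ := List.sublist_append_iff.mp hsub
  obtain ⟨νx, νd, rfl, hνx, hνd⟩ := List.sublist_append_iff.mp hν'
  have hx' := cs.wordProd_mem_closure fun i hi => hωx i (hνx.subset hi)
  have hy' := cs.wordProd_mem_closure fun i hi => hωy i (hνy.subset hi)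
  have hνd' : νd = ωd := by
    refine hνd.eq_of_length_le ?_
    rw [← hωd.eq]
    refine le_trans (hd _ (mul_mem (inv_mem hx') hx) _ (mul_mem hy (inv_mem hy'))) ?_
    refine le_trans (le_of_eq (congrArg cs.length ?_)) (cs.length_wordProd_le νd)
    simp only [wordProd_append] at hprod
    calc _ = (cs.wordProd νx)⁻¹ * (cs.wordProd ωx * cs.wordProd ωd * cs.wordProd ωy) *
          (cs.wordProd νy)⁻¹ := by simp only [mul_assoc]
      _ = _ := by rw [← hprod]; group
  subst hνd'
  refine ⟨_, hx', _, hy', by simpa only [wordProd_append] using hprod.symm, ?_⟩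
  have h1 := hred.eq
  have h2 := cs.length_wordProd_le νx
  have h3 := cs.length_wordProd_le νy
  have h4 := cs.length_mul_le (cs.wordProd νx * cs.wordProd νd) (cs.wordProd νy)
  have h5 := cs.length_mul_le (cs.wordProd νx) (cs.wordProd νd)
  have h6 := hωd.eq
  simp only [wordProd_append, List.length_append] at h1 hprod
  rw [← hprod]
  omega

/-- If `d` is minimal in `W_I d`, then `ℓ(z d) = ℓ(z) + ℓ(d)` for `z ∈ W_I`. -/
theorem length_mul_of_minimal_left {I : Set B} {d z : W}
    (hd : ∀ u ∈ Subgroup.closure (cs.simple '' I), cs.length d ≤ cs.length (u * d))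
    (hz : z ∈ Subgroup.closure (cs.simple '' I)) :
    cs.length (z * d) = cs.length z + cs.length d := by
  obtain ⟨x, -, y, hy, he, hl⟩ := cs.exists_length_add_of_minimal (I := I) (J := ∅) (d := d)
    (by simpa using hd) hz (one_mem _)
  obtain rfl : y = 1 := by simpa using hy
  obtain rfl : z = x := by simpa using he
  simpa using hl

/-- If `d` is minimal in `d W_I`, then `ℓ(d z) = ℓ(d) + ℓ(z)` for `z ∈ W_I`. -/
theorem length_mul_of_minimal_right {I : Set B} {d z : W}
    (hd : ∀ u ∈ Subgroup.closure (cs.simple '' I), cs.length d ≤ cs.length (d * u))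
    (hz : z ∈ Subgroup.closure (cs.simple '' I)) :
    cs.length (d * z) = cs.length d + cs.length z := by
  obtain ⟨x, hx, y, -, he, hl⟩ := cs.exists_length_add_of_minimal (I := ∅) (J := I) (d := d)
    (by simpa using hd) (one_mem _) hz
  obtain rfl : x = 1 := by simpa using hx
  obtain rfl : z = y := by simpa using he
  simpa using hl

/-- Every `w` is a length-additive product `x d y` with `x ∈ W_I`, `y ∈ W_J` and `d` minimal in
its double coset `W_I d W_J`. -/
theorem exists_minimal_doubleCoset (I J : Set B) (w : W) :
    ∃ x ∈ Subgroup.closure (cs.simple '' I), ∃ d, ∃ y ∈ Subgroup.closure (cs.simple '' J),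
      (∀ u ∈ Subgroup.closure (cs.simple '' I), ∀ v ∈ Subgroup.closure (cs.simple '' J),
        cs.length d ≤ cs.length (u * d * v)) ∧
      w = x * d * y ∧ cs.length w = cs.length x + cs.length d + cs.length y := by
  let P : ℕ → Prop := fun n => ∃ x ∈ Subgroup.closure (cs.simple '' I),
    ∃ y ∈ Subgroup.closure (cs.simple '' J), cs.length (x * w * y) = n
  classical
  have hP : ∃ n, P n := ⟨_, 1, one_mem _, 1, one_mem _, rfl⟩
  obtain ⟨x, hx, y, hy, hxy⟩ := Nat.find_spec hP
  have hmin : ∀ u ∈ Subgroup.closure (cs.simple '' I),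
      ∀ v ∈ Subgroup.closure (cs.simple '' J),
      cs.length (x * w * y) ≤ cs.length (u * (x * w * y) * v) := by
    intro u hu v hv
    rw [hxy]
    exact Nat.find_min' hP ⟨u * x, mul_mem hu hx, y * v, mul_mem hy hv, by simp only [mul_assoc]⟩
  obtain ⟨x', hx', y', hy', he, hl⟩ :=
    cs.exists_length_add_of_minimal hmin (inv_mem hx) (inv_mem hy)
  have hw : x⁻¹ * (x * w * y) * y⁻¹ = w := by group
  rw [hw] at he hl
  exact ⟨x', hx', _, y', hy', hmin, he, hl⟩

/-- The letters of a reduced word of an element of `W_I` all lie in `W_I`. -/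
theorem simple_mem_closure_of_isReduced {I : Set B} {ω : List B} (hω : cs.IsReduced ω)
    (hmem : cs.wordProd ω ∈ Subgroup.closure (cs.simple '' I)) :
    ∀ i ∈ ω, cs.simple i ∈ Subgroup.closure (cs.simple '' I) := by
  induction ω using List.reverseRecOn with
  | nil => simp
  | append_singleton ω i ih =>
    obtain ⟨ν, hν, -, hprod⟩ := cs.exists_isReduced_of_mem_closure hmem
    have hω' : cs.IsReduced ω := by simpa using hω.take ω.length
    have h1 : cs.wordProd (ω ++ [i]) * cs.simple i = cs.wordProd ω := by
      simp [wordProd_append]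
    have hdesc : cs.IsRightDescent (cs.wordProd ν) i := by
      rw [IsRightDescent, hprod, h1, hω'.eq, hω.eq]
      simp
    obtain ⟨j, -, he⟩ := cs.exists_eraseIdx_of_isRightDescent hdesc
    have h2 : cs.wordProd ω ∈ Subgroup.closure (cs.simple '' I) := by
      rw [← h1, ← hprod, he]
      exact cs.wordProd_mem_closure fun k hk => hν k ((List.eraseIdx_sublist ν j).subset hk)
    have h3 : cs.simple i ∈ Subgroup.closure (cs.simple '' I) := by
      rw [wordProd_append, wordProd_singleton] at hmem
      exact (Subgroup.mul_mem_cancel_left _ h2).mp hmem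
    intro k hk
    rcases List.mem_append.mp hk with hk | hk
    · exact ih hω' h2 k hk
    · rwa [List.mem_singleton.mp hk]

/-- The middle factor of a length-additive factorisation of an element of `W_I` is in `W_I`. -/
theorem mem_closure_of_length_add {I : Set B} {x d y : W}
    (hl : cs.length (x * d * y) = cs.length x + cs.length d + cs.length y)
    (hmem : x * d * y ∈ Subgroup.closure (cs.simple '' I)) :
    d ∈ Subgroup.closure (cs.simple '' I) := by
  obtain ⟨ωx, hωx, rfl⟩ := cs.exists_isReduced x
  obtain ⟨ωd, hωd, rfl⟩ := cs.exists_isReduced d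
  obtain ⟨ωy, hωy, rfl⟩ := cs.exists_isReduced y
  rw [hωx.eq, hωd.eq, hωy.eq, ← wordProd_append, ← wordProd_append] at hl
  rw [← wordProd_append, ← wordProd_append] at hmem
  have hred : cs.IsReduced (ωx ++ ωd ++ ωy) := by
    rw [IsReduced, hl]
    simp only [List.length_append]
  exact cs.wordProd_mem fun i hi => cs.simple_mem_closure_of_isReduced hred hmem i (by simp [hi])

/-- If `w` is minimal in `w W_I` and `s w` is not minimal in `s w W_I`, then `s w ∈ w W_I`. -/
theorem exists_simple_mul_eq_mul_of_minimal {I : Set B} {w : W} {i : B}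
    (hw : ∀ u ∈ Subgroup.closure (cs.simple '' I), cs.length w ≤ cs.length (w * u))
    (hn : ¬ ∀ u ∈ Subgroup.closure (cs.simple '' I),
      cs.length (cs.simple i * w) ≤ cs.length (cs.simple i * w * u)) :
    ∃ u ∈ Subgroup.closure (cs.simple '' I), cs.simple i * w = w * u := by
  obtain ⟨x, hx, d, z, hz, hd, he, hl⟩ := cs.exists_minimal_doubleCoset ∅ I (cs.simple i * w)
  obtain rfl : x = 1 := by simpa using hx
  have hd' : ∀ u ∈ Subgroup.closure (cs.simple '' I), cs.length d ≤ cs.length (d * u) := by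
    simpa using hd
  simp only [one_mul, cs.length_one, zero_add] at he hl
  have hz1 : cs.length z ≠ 0 := by
    intro h0
    obtain rfl := cs.length_eq_zero_iff.mp h0
    rw [mul_one] at he
    exact hn (he ▸ hd')
  have hwz : w * z⁻¹ = cs.simple i * d := by
    rw [mul_inv_eq_iff_eq_mul, mul_assoc, ← he, ← mul_assoc, cs.simple_mul_simple_self, one_mul]
  have hlz := cs.length_mul_of_minimal_right hw (inv_mem hz)
  have h1 := cs.length_simple_mul d i
  have h2 := cs.length_simple_mul w i
  rw [cs.length_inv] at hlz
  rw [← hwz] at h1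
  have hz2 : cs.length z = 1 := by omega
  obtain ⟨j, rfl⟩ := cs.length_eq_one_iff.mp hz2
  rw [cs.inv_simple] at hwz h1 hlz
  obtain ⟨ω, hω, rfl⟩ := cs.exists_isReduced w
  have hprod : cs.wordProd (ω ++ [j]) = cs.wordProd ω * cs.simple j := by simp [wordProd_append]
  have hdesc : cs.IsLeftDescent (cs.wordProd (ω ++ [j])) i := by
    rw [IsLeftDescent, hprod, hwz, ← mul_assoc, cs.simple_mul_simple_self, one_mul, ← hwz]
    omega
  obtain ⟨k, hk, hke⟩ := cs.exists_eraseIdx_of_isLeftDescent hdesc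
  have hωl := hω.eq
  rw [List.length_append, List.length_singleton] at hk
  refine ⟨_, hz, ?_⟩
  rcases Nat.lt_or_ge k ω.length with hkl | hkl
  · rw [List.eraseIdx_append_of_lt_length hkl, hprod, wordProd_append, wordProd_singleton,
      ← mul_assoc, mul_left_inj] at hke
    have := cs.length_wordProd_le (ω.eraseIdx k)
    have := List.length_eraseIdx_add_one hkl
    rw [← hke] at *
    omega
  · obtain rfl : k = ω.length := by omega
    rw [List.eraseIdx_append_of_length_le le_rfl, hprod, ← mul_assoc] at hke
    simp only [Nat.sub_self, List.eraseIdx_zero, List.tail_cons, List.append_nil] at hke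
    nth_rewrite 2 [← hke]
    rw [mul_assoc, cs.simple_mul_simple_self, mul_one]

end CoxeterSystem

namespace GRCSystem

variable {B R : Type*} [Monoid R] (G : GRCSystem B R)

theorem isIdempotentElem_conj {e : R} (he : IsIdempotentElem e) (w : Rˣ) :
    IsIdempotentElem ((w : R) * e * ((w⁻¹ : Rˣ) : R)) := by
  have h : e * e = e := he
  change _ * _ = _
  calc (w : R) * e * ((w⁻¹ : Rˣ) : R) * ((w : R) * e * ((w⁻¹ : Rˣ) : R))
      = (w : R) * (e * e) * ((w⁻¹ : Rˣ) : R) := by simp [mul_assoc]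
    _ = _ := by rw [h]

theorem eq_of_conj_eq_conj {f g : R} (hf : f ∈ G.Λ) (hg : g ∈ G.Λ) {w v : Rˣ}
    (h : (w : R) * f * ((w⁻¹ : Rˣ) : R) = (v : R) * g * ((v⁻¹ : Rˣ) : R)) : f = g :=
  (G.transversal _ (isIdempotentElem_conj (G.lam_idem f hf) w)).unique
    ⟨hf, w, rfl⟩ ⟨hg, v, h.symm⟩

theorem eq_of_conj_eq {f g : R} (hf : f ∈ G.Λ) (hg : g ∈ G.Λ) {w : Rˣ}
    (h : (w : R) * f * ((w⁻¹ : Rˣ) : R) = g) : f = g :=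
  G.eq_of_conj_eq_conj hf hg (v := 1) (by simpa using h)

theorem one_mem : (1 : R) ∈ G.Λ := by
  obtain ⟨f, ⟨hf, w, hw⟩, -⟩ := G.transversal 1 IsIdempotentElem.one
  have : f = 1 := by
    rw [Units.mul_inv_eq_iff_eq_mul, one_mul] at hw
    exact (Units.mul_right_inj w).mp (hw.trans (mul_one _).symm)
  exact this ▸ hf

theorem mem_parab_lam_iff {e : R} (he : e ∈ G.Λ) {w : Rˣ} :
    w ∈ G.parab (G.lam e) ↔ (w : R) * e = e * (w : R) :=
  (G.mem_lam_iff e he w).symm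

theorem mem_parab_lam_of_conj_eq {e : R} (he : e ∈ G.Λ) {w v : Rˣ}
    (h : (w : R) * e * ((w⁻¹ : Rˣ) : R) = (v : R) * e * ((v⁻¹ : Rˣ) : R)) :
    v⁻¹ * w ∈ G.parab (G.lam e) := by
  rw [G.mem_parab_lam_iff he, Units.val_mul, mul_assoc, Units.inv_mul_eq_iff_eq_mul, ← mul_assoc,
    ← mul_assoc]
  rwa [Units.mul_inv_eq_iff_eq_mul] at h

theorem mem_parab_lamStar_iff_left {e : R} (he : e ∈ G.Λ) {u : Rˣ} :
    u ∈ G.parab (G.lamStar e) ↔ (u : R) * e = e := by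
  refine ⟨fun h => ((G.mem_lamStar_iff e he u).mpr h).1, fun h => ?_⟩
  refine (G.mem_lamStar_iff e he u).mp ⟨h, ?_⟩
  have hee : e * e = e := G.lam_idem e he
  have h' : ((u⁻¹ : Rˣ) : R) * e = e := by rw [Units.inv_mul_eq_iff_eq_mul, h]
  have hF := isIdempotentElem_conj (G.lam_idem e he) u
  rw [h] at hF
  have hc := G.idem_mul_comm _ _ (G.lam_idem e he) hF
  rw [← mul_assoc, hee, mul_assoc, h', hee, Units.mul_inv_eq_iff_eq_mul] at hc
  exact hc.symm

theorem mem_parab_lamStar_iff_right {e : R} (he : e ∈ G.Λ) {u : Rˣ} :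
    u ∈ G.parab (G.lamStar e) ↔ e * (u : R) = e := by
  refine ⟨fun h => ((G.mem_lamStar_iff e he u).mpr h).2, fun h => ?_⟩
  have hee : e * e = e := G.lam_idem e he
  have h' : e * ((u⁻¹ : Rˣ) : R) = e := by rw [Units.mul_inv_eq_iff_eq_mul, h]
  have hF := isIdempotentElem_conj (G.lam_idem e he) u⁻¹
  rw [inv_inv, mul_assoc, h] at hF
  have hc := G.idem_mul_comm _ _ (G.lam_idem e he) hF
  rw [← mul_assoc, h', hee, mul_assoc, hee] at hc
  rw [G.mem_parab_lamStar_iff_left he]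
  nth_rewrite 1 [hc]
  simp

theorem idem_eq_of_mul_eq (G : GRCSystem B R) {e f : R} (he : IsIdempotentElem e) (hf : IsIdempotentElem f) {g h : Rˣ}
    (heq : e * (g : R) = f * (h : R)) : e = f := by
  have hee : e * e = e := he
  have hff : f * f = f := hf
  have h1 : e = f * (h * ((g⁻¹ : Rˣ) : R)) := by
    rw [← mul_assoc, ← heq, mul_assoc, Units.mul_inv, mul_one]
  have h2 : f = e * (g * ((h⁻¹ : Rˣ) : R)) := by
    rw [← mul_assoc, heq, mul_assoc, Units.mul_inv, mul_one]
  have h3 : f * e = e := by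
    nth_rewrite 1 [h1]
    rw [← mul_assoc, hff, ← h1]
  have h4 : e * f = f := by
    nth_rewrite 1 [h2]
    rw [← mul_assoc, hee, ← h2]
  rw [← h3, G.idem_mul_comm f e hf he, h4]

theorem eq_and_mem_of_mul_mul_eq {e f : R} (he : e ∈ G.Λ) (hf : f ∈ G.Λ) {a b c d : Rˣ}
    (heq : (a : R) * e * (b : R) = (c : R) * f * (d : R)) :
    e = f ∧ c⁻¹ * a ∈ G.parab (G.lam e) := by
  have h : (a : R) * e * ((a⁻¹ : Rˣ) : R) = (c : R) * f * ((c⁻¹ : Rˣ) : R) := by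
    refine G.idem_eq_of_mul_eq (isIdempotentElem_conj (G.lam_idem e he) a)
      (isIdempotentElem_conj (G.lam_idem f hf) c) (g := a * b) (h := c * d) ?_
    simpa [mul_assoc] using heq
  obtain rfl := G.eq_of_conj_eq_conj he hf h
  exact ⟨rfl, G.mem_parab_lam_of_conj_eq he h⟩

/-- Modulo `W_⋆(e)`, every `z ∈ W(e)` is equal to an element of `W_{λ^⋆(e)}` which is no longer. -/
theorem exists_mem_parab_lamCostar {e : R} (he : e ∈ G.Λ) {z : Rˣ} (hz : z ∈ G.parab (G.lam e)) :
    ∃ y ∈ G.parab (G.lamCostar e), (y : R) * e = (z : R) * e ∧ G.cs.length y ≤ G.cs.length z := by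
  have key : ∀ ω : List B, (∀ i ∈ ω, i ∈ G.lam e) → ∃ ν : List B, (∀ i ∈ ν, i ∈ G.lamCostar e) ∧
      (G.cs.wordProd ν : R) * e = (G.cs.wordProd ω : R) * e ∧ ν.length ≤ ω.length := by
    intro ω hω
    induction ω with
    | nil => exact ⟨[], by simp, rfl, le_rfl⟩
    | cons i ω ih =>
      obtain ⟨ν, hν, hνω, hl⟩ := ih fun j hj => hω j (List.mem_cons_of_mem _ hj)
      have hi : (G.cs.simple i : R) * e = e * (G.cs.simple i : R) :=
        (G.mem_parab_lam_iff he).mp (Subgroup.subset_closure ⟨i, hω i List.mem_cons_self, rfl⟩)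
      by_cases hie : (G.cs.simple i : R) * e = e
      · refine ⟨ν, hν, ?_, hl.trans (by simp)⟩
        have hωe : (G.cs.wordProd ω : R) * e = e * (G.cs.wordProd ω : R) :=
          (G.mem_parab_lam_iff he).mp
            (G.cs.wordProd_mem_closure fun j hj => hω j (List.mem_cons_of_mem _ hj))
        rw [hνω, CoxeterSystem.wordProd_cons, Units.val_mul, mul_assoc, hωe, ← mul_assoc, hie]
      · refine ⟨i :: ν, ?_, ?_, by simpa using hl⟩
        · intro j hj
          rcases List.mem_cons.mp hj with rfl | hj
          · exact ⟨hi, hie⟩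
          · exact hν j hj
        · simp only [CoxeterSystem.wordProd_cons, Units.val_mul, mul_assoc, hνω]
  obtain ⟨ω, hω, hred, rfl⟩ := G.cs.exists_isReduced_of_mem_closure hz
  obtain ⟨ν, hν, hνω, hl⟩ := key ω hω
  exact ⟨_, G.cs.wordProd_mem_closure hν, hνω,
    (G.cs.length_wordProd_le ν).trans (hl.trans hred.eq.ge)⟩

/-- The normal decomposition minimises `ℓ(a) + ℓ(b)` among the expressions `r = a e b`. -/
theorem IsNormalDecomp.length_le {G : GRCSystem B R} {r e f : R} {w₁ w₂ a b : Rˣ}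
    (h : G.IsNormalDecomp r w₁ e w₂) (hf : f ∈ G.Λ) (hr : r = (a : R) * f * (b : R)) :
    G.cs.length w₁ + G.cs.length w₂ ≤ G.cs.length a + G.cs.length b := by
  obtain ⟨he, h1, h2, h3⟩ := h
  rw [h3] at hr
  obtain ⟨hfe, hv⟩ := G.eq_and_mem_of_mul_mul_eq hf he hr.symm
  rw [hfe] at hr hv
  obtain ⟨v, hvdef⟩ : ∃ v, v = w₁⁻¹ * a := ⟨_, rfl⟩
  rw [← hvdef] at hv
  obtain rfl : a = w₁ * v := by rw [hvdef]; group
  have hve := (G.mem_parab_lam_iff he).mp hv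
  have hvb : e * ((v * b * w₂⁻¹ : Rˣ) : R) = e := by
    rw [Units.val_mul, ← mul_assoc, Units.mul_inv_eq_iff_eq_mul, Units.val_mul, ← mul_assoc,
      ← hve]
    rw [Units.val_mul] at hr
    simpa [mul_assoc] using hr.symm
  have hu := (G.mem_parab_lamStar_iff_right he).mpr hvb
  have hu' : v * b * w₂⁻¹ ∈ G.parab (G.lam e) := by
    rw [G.mem_parab_lam_iff he, hvb, (G.mem_parab_lamStar_iff_left he).mp hu]
  have hz : b * w₂⁻¹ ∈ G.parab (G.lam e) := by
    rwa [mul_assoc, Subgroup.mul_mem_cancel_left _ hv] at hu'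
  obtain ⟨z, hzdef⟩ : ∃ z, z = b * w₂⁻¹ := ⟨_, rfl⟩
  rw [← hzdef] at hz
  obtain rfl : b = z * w₂ := by rw [hzdef]; group
  have hlb := G.cs.length_mul_of_minimal_left h2 hz
  obtain ⟨y, hy, hyz, hly⟩ := G.exists_mem_parab_lamCostar he hz
  have hvy : v * y ∈ G.parab (G.lamStar e) := by
    rw [G.mem_parab_lamStar_iff_left he, Units.val_mul, mul_assoc, hyz,
      (G.mem_parab_lam_iff he).mp hz, ← mul_assoc, hve, mul_assoc, ← Units.val_mul]
    simpa [mul_assoc] using hvb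
  have h4 := h1 _ hvy
  rw [← mul_assoc] at h4
  have h5 := G.cs.length_mul_le (w₁ * v) y
  omega

theorem mul_mul_mem_of_minimal {f e : R} (hf : f ∈ G.Λ) (he : e ∈ G.Λ) {d : Rˣ}
    (hd : G.IsRed (G.lam f) (G.lam e) d) : f * (d : R) * e ∈ G.Λ := by
  have hff := G.lam_idem f hf
  have hee := G.lam_idem e he
  have idem_mul : ∀ {a b : R}, IsIdempotentElem a → IsIdempotentElem b →
      IsIdempotentElem (a * b) := fun ha hb => ha.mul_of_commute (G.idem_mul_comm _ _ ha hb) hb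
  have hE := isIdempotentElem_conj hee d
  have hF := isIdempotentElem_conj hff d⁻¹
  obtain ⟨h, hh⟩ : ∃ h, h = f * ((d : R) * e * ((d⁻¹ : Rˣ) : R)) := ⟨_, rfl⟩
  have hhi : IsIdempotentElem h := hh ▸ idem_mul hff hE
  have hfh : f * h = h := by rw [hh, ← mul_assoc, hff.eq]
  have hhf : h * f = h := by rw [G.idem_mul_comm _ _ hhi hff, hfh]
  obtain ⟨w, h₁, f₂, hh₁, hf₂, hle, -, hw₁, hw₂⟩ := G.ecs4 h f hhi hff hhf hfh
  obtain rfl := G.eq_of_conj_eq hf₂ hf hw₂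
  have hw : w ∈ G.parab (G.lam f₂) := by
    rwa [G.mem_parab_lam_iff hf, ← Units.mul_inv_eq_iff_eq_mul]
  obtain ⟨k, hk⟩ : ∃ k, k = ((d⁻¹ : Rˣ) : R) * f₂ * (((d⁻¹)⁻¹ : Rˣ) : R) * e := ⟨_, rfl⟩
  have hki : IsIdempotentElem k := hk ▸ idem_mul hF hee
  have hke : k * e = k := by rw [hk, mul_assoc, hee.eq]
  have hek : e * k = k := by rw [G.idem_mul_comm _ _ hee hki, hke]
  obtain ⟨v, g, e₂, hg, he₂, hge, -, hv₁, hv₂⟩ := G.ecs4 k e hki hee hke hek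
  obtain rfl := G.eq_of_conj_eq he₂ he hv₂
  have hv : v ∈ G.parab (G.lam e₂) := by
    rwa [G.mem_parab_lam_iff he, ← Units.mul_inv_eq_iff_eq_mul]
  have hdv : ((d * v : Rˣ) : R) * g * (((d * v)⁻¹ : Rˣ) : R) = h := by
    have : (d : R) * k * ((d⁻¹ : Rˣ) : R) = h := by rw [hk, hh]; simp [mul_assoc]
    rw [← this, ← hv₁]
    simp [mul_assoc]
  obtain rfl := G.eq_of_conj_eq_conj hg hh₁ (hdv.trans hw₁.symm)
  have hz := G.mem_parab_lam_of_conj_eq hg (hdv.trans hw₁.symm)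
  obtain ⟨y, hy, hyz, -⟩ := G.exists_mem_parab_lamCostar hg hz
  have hyf : y ∈ G.parab (G.lam f₂) := by
    refine (Subgroup.closure_le _).mpr ?_ hy
    rintro _ ⟨s, hs, rfl⟩
    exact (G.mem_parab_lam_iff hf).mpr (G.ecs6 g hg f₂ hf hle s hs).1
  have hstar : y⁻¹ * w⁻¹ * d * v ∈ G.parab (G.lamStar g) := by
    rw [G.mem_parab_lamStar_iff_left hg]
    rw [show y⁻¹ * w⁻¹ * d * v = y⁻¹ * (w⁻¹ * (d * v)) by simp only [mul_assoc], Units.val_mul,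
      mul_assoc, ← hyz, Units.inv_mul_cancel_left]
  obtain ⟨x', -, y', -, hxy, hl⟩ := G.cs.exists_length_add_of_minimal hd
    (mul_mem (inv_mem hyf) (inv_mem hw)) hv
  rw [hxy] at hstar hl
  have hdg := G.cs.mem_closure_of_length_add hl hstar
  have hgd : g * (d : R) = g := (G.mem_parab_lamStar_iff_right hg).mp hdg
  have hgd' : g * ((d⁻¹ : Rˣ) : R) = g := by rw [Units.mul_inv_eq_iff_eq_mul, hgd]
  have hgh : g * h = g := by
    rw [hh, ← mul_assoc, hle, ← mul_assoc, ← mul_assoc, hgd, hge, hgd']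
  have hhg : h * g = g := by rw [G.idem_mul_comm _ _ hhi (G.lam_idem g hg), hgh]
  obtain ⟨t, g₁, g₂, hg₁, hg₂, -, -, ht₁, ht₂⟩ := G.ecs4 g h (G.lam_idem g hg) hhi hgh hhg
  obtain rfl := G.eq_of_conj_eq hg₁ hg ht₁
  obtain rfl := G.eq_of_conj_eq_conj hg₂ hg₁ (ht₂.trans hw₁.symm)
  have hgh' : g₂ = h := ht₁.symm.trans ht₂
  have : f₂ * (d : R) * e₂ = h * (d : R) := by rw [hh]; simp [mul_assoc]
  rw [this, ← hgh', hgd]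
  exact hg

theorem exists_mul_mul_of_mem {f e : R} (hf : f ∈ G.Λ) (he : e ∈ G.Λ) (a : Rˣ) :
    ∃ x y : Rˣ, ∃ g ∈ G.Λ, f * (a : R) * e = (x : R) * g * (y : R) ∧
      G.cs.length x + G.cs.length y ≤ G.cs.length a := by
  obtain ⟨x, hx, d, y, hy, hd, rfl, hl⟩ :=
    G.cs.exists_minimal_doubleCoset (G.lam f) (G.lam e) a
  refine ⟨x, y, _, G.mul_mul_mem_of_minimal hf he hd, ?_, by omega⟩
  have h1 := (G.mem_parab_lam_iff hf).mp hx
  have h2 := (G.mem_parab_lam_iff he).mp hy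
  calc f * ((x * d * y : Rˣ) : R) * e = (f * (x : R)) * d * ((y : R) * e) := by
        simp only [Units.val_mul, mul_assoc]
    _ = _ := by rw [← h1, h2]; simp only [mul_assoc]

theorem exists_of_isWord {l : List (B ⊕ R)} (hl : G.IsWord l) :
    ∃ a b : Rˣ, ∃ e ∈ G.Λ, (l.map G.letterVal).prod = (a : R) * e * (b : R) ∧
      G.cs.length a + G.cs.length b ≤ wordLen l := by
  induction l with
  | nil => exact ⟨1, 1, 1, G.one_mem, by simp, by simp⟩
  | cons c l ih =>
    obtain ⟨a, b, e, he, hprod, hlen⟩ := ih fun f hf => hl f (List.mem_cons_of_mem _ hf)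
    rw [List.map_cons, List.prod_cons, hprod]
    cases c with
    | inl i =>
      refine ⟨G.cs.simple i * a, b, e, he, by simp [letterVal, mul_assoc], ?_⟩
      have h1 := G.cs.length_mul_le (G.cs.simple i) a
      have h2 : wordLen (Sum.inl i :: l) = wordLen l + 1 := rfl
      rw [G.cs.length_simple] at h1
      omega
    | inr f =>
      obtain ⟨x, y, g, hg, hxy, hlxy⟩ :=
        G.exists_mul_mul_of_mem (hl f List.mem_cons_self).1 he a
      refine ⟨x, y * b, g, hg, ?_, ?_⟩
      · rw [Units.val_mul, ← mul_assoc (_ * g), ← hxy]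
        simp only [letterVal, Sum.elim_inr, id_eq, mul_assoc]
      · have h1 := G.cs.length_mul_le y b
        have h2 : wordLen (Sum.inr f :: l) = wordLen l := rfl
        omega

theorem exists_isWord {e : R} (he : e ∈ G.Λ) (a b : Rˣ) :
    ∃ l : List (B ⊕ R), G.IsWord l ∧ (l.map G.letterVal).prod = (a : R) * e * (b : R) ∧
      wordLen l = G.cs.length a + G.cs.length b := by
  have hword : ∀ ω : List B, ((ω.map (Sum.inl : B → B ⊕ R)).map G.letterVal).prod =
      (G.cs.wordProd ω : R) := by
    intro ω
    induction ω with
    | nil => simp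
    | cons i ω ih =>
      rw [List.map_cons, List.map_cons, List.prod_cons, ih, CoxeterSystem.wordProd_cons]
      rfl
  have hlen : ∀ ω : List B, wordLen (ω.map (Sum.inl : B → B ⊕ R)) = ω.length := by
    intro ω
    simp [wordLen, List.filter_map, Function.comp_def]
  have happ : ∀ l l' : List (B ⊕ R), wordLen (l ++ l') = wordLen l + wordLen l' := by
    intro l l'
    simp [wordLen]
  obtain ⟨α, hα, rfl⟩ := G.cs.exists_isReduced a
  obtain ⟨β, hβ, rfl⟩ := G.cs.exists_isReduced b
  by_cases he1 : e = 1
  · refine ⟨α.map Sum.inl ++ β.map Sum.inl, by simp [IsWord], ?_, ?_⟩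
    · rw [List.map_append, List.prod_append, hword, hword, he1, mul_one]
    · rw [happ, hlen, hlen, hα.eq, hβ.eq]
  · refine ⟨α.map Sum.inl ++ ([Sum.inr e] ++ β.map Sum.inl), ?_, ?_, ?_⟩
    · simpa [IsWord] using ⟨he, he1⟩
    · rw [List.map_append, List.prod_append, List.map_append, List.prod_append, hword, hword]
      simp [letterVal, mul_assoc]
    · rw [happ, happ, hlen, hlen, hα.eq, hβ.eq]
      simp [wordLen]

theorem IsNormalDecomp.len_eq {G : GRCSystem B R} {r e : R} {w₁ w₂ : Rˣ}
    (h : G.IsNormalDecomp r w₁ e w₂) :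
    G.len r = G.cs.length w₁ + G.cs.length w₂ := by
  obtain ⟨l, hl, hprod, hlen⟩ := G.exists_isWord h.1 w₁ w₂
  have hmem : G.cs.length w₁ + G.cs.length w₂ ∈ {n : ℕ | ∃ l : List (B ⊕ R), G.IsWord l ∧
      (l.map G.letterVal).prod = r ∧ n = wordLen l} :=
    ⟨l, hl, hprod.trans h.2.2.2.symm, hlen.symm⟩
  refine le_antisymm (Nat.sInf_le hmem) ?_
  obtain ⟨l', hl', hprod', hlen'⟩ := Nat.sInf_mem ⟨_, hmem⟩
  obtain ⟨a, b, f, hf, hab, hle⟩ := G.exists_of_isWord hl'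
  rw [len, hlen']
  exact (h.length_le hf (hprod'.symm.trans hab)).trans hle

theorem IsNormalDecomp.exists_lamStar_of_mem {G : GRCSystem B R} {r e : R} {w₁ w₂ : Rˣ}
    (h : G.IsNormalDecomp r w₁ e w₂) {s : B} {z : Rˣ} (hz : z ∈ G.parab (G.lamStar e))
    (hs : G.cs.simple s * w₁ = w₁ * z) :
    (∃ u ∈ G.lamStar e, G.cs.simple s * w₁ = w₁ * G.cs.simple u) ∧
      G.cs.length (G.cs.simple s * w₁) = G.cs.length w₁ + 1 := by
  have hl := G.cs.length_mul_of_minimal_right h.2.1 hz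
  rw [← hs] at hl
  have h1 := G.cs.length_simple_mul w₁ s
  have hz1 : G.cs.length z = 1 := by omega
  obtain ⟨ω, hω, hred, rfl⟩ := G.cs.exists_isReduced_of_mem_closure hz
  rw [hred.eq] at hz1
  obtain ⟨u, rfl⟩ := List.length_eq_one_iff.mp hz1
  exact ⟨⟨u, hω u (by simp), by simpa using hs⟩, by omega⟩

theorem IsNormalDecomp.simple_mul_eq_self_iff {G : GRCSystem B R} {r e : R} {w₁ w₂ : Rˣ}
    (h : G.IsNormalDecomp r w₁ e w₂) (s : B) :
    (G.cs.simple s : R) * r = r ↔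
      ∃ z ∈ G.parab (G.lamStar e), G.cs.simple s * w₁ = w₁ * z := by
  obtain ⟨he, -, -, rfl⟩ := h
  constructor
  · intro hs
    refine ⟨w₁⁻¹ * (G.cs.simple s * w₁), ?_, by group⟩
    rw [← mul_assoc, Units.mul_left_inj, ← mul_assoc] at hs
    rw [G.mem_parab_lamStar_iff_left he, Units.val_mul, mul_assoc, Units.inv_mul_eq_iff_eq_mul,
      Units.val_mul, hs]
  · rintro ⟨z, hz, hs⟩
    rw [← mul_assoc, ← mul_assoc, ← Units.val_mul, hs, Units.val_mul, mul_assoc (w₁ : R),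
      (G.mem_parab_lamStar_iff_left he).mp hz]

theorem IsNormalDecomp.simple_mul {G : GRCSystem B R} {r e : R} {w₁ w₂ : Rˣ}
    (h : G.IsNormalDecomp r w₁ e w₂) {s : B} (hs : (G.cs.simple s : R) * r ≠ r) :
    G.IsNormalDecomp ((G.cs.simple s : R) * r) (G.cs.simple s * w₁) e w₂ := by
  refine ⟨h.1, ?_, h.2.2.1, ?_⟩
  · by_contra hn
    exact hs ((h.simple_mul_eq_self_iff s).mpr
      (G.cs.exists_simple_mul_eq_mul_of_minimal h.2.1 hn))
  · rw [h.2.2.2, Units.val_mul]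
    simp only [mul_assoc]

end GRCSystem

/-- for `r` with normal decomposition `(w₁, e, w₂)` and `s ∈ S`:
`ℓ(sr) = ℓ(r)` iff `sr = r` iff `s w₁ = w₁ u` for some `u ∈ λ_⋆(e)`, in which case
`ℓ(s w₁) = ℓ(w₁) + 1`; otherwise `ℓ(sr) = ℓ(r) ± 1`, which happens exactly when the normal
decomposition of `sr` is `(s w₁, e, w₂)`, and then `ℓ(sr) − ℓ(r) = ℓ(s w₁) − ℓ(w₁)`. -/
theorem len_simple_mul
    {B R : Type*} [Monoid R] (G : GRCSystem B R)
    (r : R) (w₁ : Rˣ) (e : R) (w₂ : Rˣ)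
    (h : G.IsNormalDecomp r w₁ e w₂) (s : B) :
    (G.len ((G.cs.simple s : R) * r) = G.len r ↔ (G.cs.simple s : R) * r = r) ∧
    ((G.cs.simple s : R) * r = r ↔
      ∃ u ∈ G.lamStar e, G.cs.simple s * w₁ = w₁ * G.cs.simple u) ∧
    ((G.cs.simple s : R) * r = r →
      G.cs.length (G.cs.simple s * w₁) = G.cs.length w₁ + 1) ∧
    ((G.len ((G.cs.simple s : R) * r) = G.len r + 1 ∨
        G.len ((G.cs.simple s : R) * r) + 1 = G.len r) ↔
      G.IsNormalDecomp ((G.cs.simple s : R) * r) (G.cs.simple s * w₁) e w₂) ∧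
    (G.len ((G.cs.simple s : R) * r) ≠ G.len r →
      (G.len ((G.cs.simple s : R) * r) : ℤ) - (G.len r : ℤ)
        = (G.cs.length (G.cs.simple s * w₁) : ℤ) - (G.cs.length w₁ : ℤ)) := by
  have hself := h.simple_mul_eq_self_iff s
  have hlen := h.len_eq
  have hstep := G.cs.length_simple_mul w₁ s
  have hne : (G.cs.simple s : R) * r ≠ r →
      G.len ((G.cs.simple s : R) * r) = G.cs.length (G.cs.simple s * w₁) + G.cs.length w₂ :=
    fun hs => (h.simple_mul hs).len_eq
  refine ⟨⟨fun hl => ?_, fun hs => by rw [hs]⟩, ⟨fun hs => ?_, ?_⟩, fun hs => ?_,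
    ⟨fun hl => ?_, fun hn => ?_⟩, fun hl => ?_⟩
  · by_contra hs
    have := hne hs
    omega
  · obtain ⟨z, hz, hzs⟩ := hself.mp hs
    exact (h.exists_lamStar_of_mem hz hzs).1
  · rintro ⟨u, hu, hus⟩
    exact hself.mpr ⟨_, Subgroup.subset_closure ⟨u, hu, rfl⟩, hus⟩
  · obtain ⟨z, hz, hzs⟩ := hself.mp hs
    exact (h.exists_lamStar_of_mem hz hzs).2
  · refine h.simple_mul fun hs => ?_
    rw [hs] at hl
    omega
  · have := hn.len_eq
    omega
  · have := hne fun hs => hl (by rw [hs])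
    omega
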